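/- Let φ : ℝⁿ → ℝ be convex and differentiable with L-Lipschitz gradient, L > 0. Then ∇φ is (1/L)-cocoercive: ⟨∇φ(x) − ∇φ(y), x − y⟩ ≥ (1/L)·‖∇φ(x) − ∇φ(y)‖² for all x, y ∈ ℝⁿ. -/

import Mathlib

open scoped InnerProductSpace

section Gradient

variable {E : Type*} [NormedAddCommGroup E] [InnerProductSpace ℝ E] [CompleteSpace E]
  {φ : E → ℝ}

/-- The derivative of a differentiable function along a line, in terms of its gradient. -/
lemma Differentiable.hasDerivAt_comp_line (hφ : Differentiable ℝ φ) (x v : E) (t : ℝ) :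
    HasDerivAt (fun s : ℝ => φ (x + s • v)) ⟪gradient φ (x + t • v), v⟫_ℝ t := by
  have hline : HasDerivAt (fun s : ℝ => x + s • v) v t := by
    simpa using ((hasDerivAt_id t).smul_const v).const_add x
  exact (hφ (x + t • v)).hasGradientAt.hasFDerivAt.comp_hasDerivAt t hline

/-- A differentiable convex function lies above its tangent hyperplanes. -/
lemma ConvexOn.add_inner_gradient_le (hconv : ConvexOn ℝ Set.univ φ)
    (hφ : Differentiable ℝ φ) (x v : E) :
    φ x + ⟪gradient φ x, v⟫_ℝ ≤ φ (x + v) := by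
  have hline : ConvexOn ℝ Set.univ (fun s : ℝ => φ (x + s • v)) := by
    refine ⟨convex_univ, fun a _ b _ p q hp hq hpq => ?_⟩
    have h := hconv.2 (Set.mem_univ (x + a • v)) (Set.mem_univ (x + b • v)) hp hq hpq
    convert h using 2
    obtain rfl : p = 1 - q := by linarith
    simp only [smul_eq_mul]
    module
  have h := hline.le_slope_of_hasDerivAt (Set.mem_univ 0) (Set.mem_univ 1) one_pos
    (hφ.hasDerivAt_comp_line x v 0)
  simp [slope_def_field] at h ⊢
  linarith

/-- The descent lemma: a function with `L`-Lipschitz gradient lies below its quadratic upper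
model. -/
lemma Differentiable.le_add_inner_gradient_add_sq (hφ : Differentiable ℝ φ) {L : ℝ}
    (hlip : ∀ x y, ‖gradient φ x - gradient φ y‖ ≤ L * ‖x - y‖) (x v : E) :
    φ (x + v) ≤ φ x + ⟪gradient φ x, v⟫_ℝ + L / 2 * ‖v‖ ^ 2 := by
  have hd (t : ℝ) : HasDerivAt
      (fun s : ℝ => φ (x + s • v) - s * ⟪gradient φ x, v⟫_ℝ - s ^ 2 * (L / 2 * ‖v‖ ^ 2))
      (⟪gradient φ (x + t • v), v⟫_ℝ - ⟪gradient φ x, v⟫_ℝ - t * (L * ‖v‖ ^ 2)) t := by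
    refine (((hφ.hasDerivAt_comp_line x v t).sub
      ((hasDerivAt_id t).mul_const ⟪gradient φ x, v⟫_ℝ)).sub
      ((hasDerivAt_pow 2 t).mul_const (L / 2 * ‖v‖ ^ 2))).congr_deriv ?_
    push_cast
    ring
  have hanti := antitoneOn_of_deriv_nonpos (convex_Icc (0 : ℝ) 1)
    (fun t _ => (hd t).continuousAt.continuousWithinAt)
    (fun t _ => (hd t).differentiableAt.differentiableWithinAt) (fun t ht => by
      rw [interior_Icc] at ht
      rw [(hd t).deriv, ← inner_sub_left]
      have h := hlip (x + t • v) x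
      rw [add_sub_cancel_left, norm_smul, Real.norm_of_nonneg ht.1.le] at h
      have h' := real_inner_le_norm (gradient φ (x + t • v) - gradient φ x) v
      nlinarith [mul_le_mul_of_nonneg_right h (norm_nonneg v)])
  have h := hanti (Set.left_mem_Icc.2 zero_le_one) (Set.right_mem_Icc.2 zero_le_one) zero_le_one
  simp at h ⊢
  linarith

/-- A convex function with `L`-Lipschitz gradient exceeds its tangent hyperplanes by a multiple of
the squared gradient difference. -/
lemma ConvexOn.add_inner_gradient_add_sq_le (hconv : ConvexOn ℝ Set.univ φ)
    (hφ : Differentiable ℝ φ) {L : ℝ} (hL : 0 < L)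
    (hlip : ∀ x y, ‖gradient φ x - gradient φ y‖ ≤ L * ‖x - y‖) (x y : E) :
    φ x + ⟪gradient φ x, y - x⟫_ℝ + 1 / (2 * L) * ‖gradient φ x - gradient φ y‖ ^ 2 ≤ φ y := by
  set d := gradient φ x - gradient φ y with hd
  have hlow := hconv.add_inner_gradient_le hφ x ((y - x) + (1 / L) • d)
  have hupp := hφ.le_add_inner_gradient_add_sq hlip y ((1 / L) • d)
  rw [← add_assoc, add_sub_cancel, inner_add_right, real_inner_smul_right] at hlow
  rw [real_inner_smul_right, norm_smul, mul_pow, Real.norm_of_nonneg (by positivity)] at hupp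
  have hsq : ⟪gradient φ x, d⟫_ℝ - ⟪gradient φ y, d⟫_ℝ = ‖d‖ ^ 2 := by
    rw [← inner_sub_left, ← hd, real_inner_self_eq_norm_sq]
  have hscale : L / 2 * ((1 / L) ^ 2 * ‖d‖ ^ 2) =
      1 / L * (⟪gradient φ x, d⟫_ℝ - ⟪gradient φ y, d⟫_ℝ) - 1 / (2 * L) * ‖d‖ ^ 2 := by
    rw [hsq]
    field_simp
    ring
  linarith

end Gradient

/-- **Baillon–Haddad / cocoercivity.** If `φ` is convex and differentiable with
`L`-Lipschitz gradient, then `∇φ` is `(1/L)`-cocoercive: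
`⟨∇φ(x) − ∇φ(y), x − y⟩ ≥ (1/L)‖∇φ(x) − ∇φ(y)‖²`. -/
theorem gradient_cocoercive_of_convex_lipschitz {n : ℕ}
    (φ : EuclideanSpace ℝ (Fin n) → ℝ) (L : ℝ) (hL : 0 < L)
    (hconv : ConvexOn ℝ Set.univ φ)
    (hφ : Differentiable ℝ φ)
    (hlip : ∀ x y, ‖gradient φ x - gradient φ y‖ ≤ L * ‖x - y‖) :
    ∀ x y : EuclideanSpace ℝ (Fin n),
      1 / L * ‖gradient φ x - gradient φ y‖ ^ 2 ≤
        ⟪gradient φ x - gradient φ y, x - y⟫_ℝ := by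
  intro x y
  have hxy := hconv.add_inner_gradient_add_sq_le hφ hL hlip x y
  have hyx := hconv.add_inner_gradient_add_sq_le hφ hL hlip y x
  rw [norm_sub_rev (gradient φ y)] at hyx
  rw [← neg_sub x y, inner_neg_right] at hxy
  rw [inner_sub_left]
  have hhalf : 1 / L * ‖gradient φ x - gradient φ y‖ ^ 2 =
      2 * (1 / (2 * L) * ‖gradient φ x - gradient φ y‖ ^ 2) := by
    field_simp
  linarith
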